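/- The argmax link is 1/(2n)-separated with respect to (L_k, ℓ_k): let ψ : ℝ^n → R_k be any function such that for every u ∈ ℝ^n, Σ_{i∈ψ(u)} u_i = σ_k(u). Then for every p in the simplex Δ, every u ∈ ℝ^n minimizing u' ↦ Σ_{y∈Y} p_y L_k(u',y) over ℝ^n, and every u' ∈ ℝ^n with ψ(u') ∉ γ_k(p), we have ‖u − u'‖_∞ = max_i |u_i − u'_i| ≥ 1/(2n). -/

import Mathlib

open scoped NNReal

def simplex (n : ℕ) : Set (Fin n → ℝ) := {p | (∀ i, 0 ≤ p i) ∧ ∑ i, p i = 1}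

noncomputable def sigmaTop (n m : ℕ) (u : Fin n → ℝ) : ℝ :=
  if h : ((Finset.univ : Finset (Fin n)).powersetCard m).Nonempty then
    ((Finset.univ : Finset (Fin n)).powersetCard m).sup' h (fun S => ∑ i ∈ S, u i)
  else 0

noncomputable def Lk (n k : ℕ) (u : Fin n → ℝ) (y : Fin n) : ℝ :=
  if h : (Finset.Icc 1 n).Nonempty then
    (Finset.Icc 1 n).sup' h
      (fun m => sigmaTop n m u / (m : ℝ) + max 0 (1 - (k : ℝ) / (m : ℝ))) - u y
  else 0

def indic {n : ℕ} (S : Finset (Fin n)) : Fin n → ℝ := fun i => if i ∈ S then 1 else 0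

noncomputable def nthLarge {n : ℕ} (v : Fin n → ℝ) (j : ℕ) : ℝ :=
  if h : n - j < n then v (Tuple.sort v ⟨n - j, h⟩) else 0

noncomputable def L2 (n k : ℕ) (u : Fin n → ℝ) (y : Fin n) : ℝ :=
  max 0 (1 - u y + (1 / (k : ℝ)) * sigmaTop n k (u - Pi.single y 1))

noncomputable def L3 (n k : ℕ) (u : Fin n → ℝ) (y : Fin n) : ℝ :=
  (1 / (k : ℝ)) * ∑ i ∈ Finset.Icc 1 k, max 0 (1 - u y + nthLarge (u - Pi.single y 1) i)

noncomputable def sigmaExcl (n k : ℕ) (u : Fin n → ℝ) (y : Fin n) : ℝ :=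
  if h : ((Finset.univ.erase y).powersetCard k).Nonempty then
    ((Finset.univ.erase y).powersetCard k).sup' h (fun S => ∑ i ∈ S, u i)
  else 0

noncomputable def L4 (n k : ℕ) (u : Fin n → ℝ) (y : Fin n) : ℝ :=
  max 0 (1 - u y + (1 / (k : ℝ)) * sigmaExcl n k u y)

noncomputable def ell2 (k : ℕ) {n : ℕ} (H M : Finset (Fin n)) (y : Fin n) : ℝ :=
  if y ∈ H then 0
  else if y ∈ M then ((H.card : ℝ) + M.card - 1) / ((k : ℝ) - H.card)
  else ((H.card : ℝ) + M.card - 1) / ((k : ℝ) - H.card) + ((k : ℝ) + 1) / k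

noncomputable def ell4 (k : ℕ) {n : ℕ} (T : Finset (Fin n)) (y : Fin n) : ℝ :=
  if y ∈ T then 0 else ((k : ℝ) + 1) / ((k : ℝ) + 1 - T.card)


theorem sum_le_sigmaTop {n : ℕ} (u : Fin n → ℝ) (S : Finset (Fin n)) :
    ∑ i ∈ S, u i ≤ sigmaTop n S.card u := by
  have hS : S ∈ (Finset.univ : Finset (Fin n)).powersetCard S.card := by
    simp [Finset.mem_powersetCard]
  unfold sigmaTop
  rw [dif_pos ⟨S, hS⟩]
  exact Finset.le_sup' (fun S => ∑ i ∈ S, u i) hS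

theorem exists_card_eq_sum_eq_sigmaTop {n m : ℕ} (hm : m ≤ n) (u : Fin n → ℝ) :
    ∃ S : Finset (Fin n), S.card = m ∧ ∑ i ∈ S, u i = sigmaTop n m u := by
  have hne : ((Finset.univ : Finset (Fin n)).powersetCard m).Nonempty := by
    rw [Finset.powersetCard_nonempty]; simpa using hm
  obtain ⟨S, hS, h⟩ := Finset.exists_mem_eq_sup' hne (fun S => ∑ i ∈ S, u i)
  refine ⟨S, (Finset.mem_powersetCard.1 hS).2, ?_⟩
  unfold sigmaTop
  rw [dif_pos hne, h]

/-- A set of maximal sum among the sets of its size contains the larger entries. -/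
theorem le_of_mem_of_notMem_of_sum_eq_sigmaTop {n k : ℕ} {u : Fin n → ℝ} {S : Finset (Fin n)}
    (hc : S.card = k) (hS : ∑ i ∈ S, u i = sigmaTop n k u) {i j : Fin n}
    (hi : i ∈ S) (hj : j ∉ S) : u j ≤ u i := by
  have hj' : j ∉ S.erase i := fun h => hj (Finset.mem_of_mem_erase h)
  have h := sum_le_sigmaTop u (insert j (S.erase i))
  rw [Finset.card_insert_of_notMem hj', Finset.card_erase_add_one hi, hc, ← hS,
    Finset.sum_insert hj', ← Finset.add_sum_erase S u hi] at h
  linarith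

/-- The convex part of the surrogate `Lk`, which does not depend on the label. -/
noncomputable def Gk (n k : ℕ) (u : Fin n → ℝ) : ℝ :=
  if h : (Finset.Icc 1 n).Nonempty then
    (Finset.Icc 1 n).sup' h
      (fun m => sigmaTop n m u / (m : ℝ) + max 0 (1 - (k : ℝ) / (m : ℝ)))
  else 0

theorem Lk_eq_Gk_sub {n : ℕ} (hn : 1 ≤ n) (k : ℕ) (u : Fin n → ℝ) (y : Fin n) :
    Lk n k u y = Gk n k u - u y := by
  have h : (Finset.Icc 1 n).Nonempty := Finset.nonempty_Icc.2 hn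
  unfold Lk Gk
  rw [dif_pos h, dif_pos h]

theorem sum_mul_Lk {n : ℕ} (hn : 1 ≤ n) (k : ℕ) {p : Fin n → ℝ} (hp : ∑ i, p i = 1)
    (u : Fin n → ℝ) : ∑ y, p y * Lk n k u y = Gk n k u - ∑ y, p y * u y := by
  simp only [Lk_eq_Gk_sub hn, mul_sub, Finset.sum_sub_distrib, ← Finset.sum_mul, hp, one_mul]

theorem sum_div_card_add_le_Gk {n : ℕ} (k : ℕ) (u : Fin n → ℝ) {S : Finset (Fin n)}
    (hS : S.Nonempty) :
    (∑ i ∈ S, u i) / S.card + max 0 (1 - (k : ℝ) / S.card) ≤ Gk n k u := by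
  have hc : S.card ∈ Finset.Icc 1 n :=
    Finset.mem_Icc.2 ⟨hS.card_pos, by simpa using Finset.card_le_univ S⟩
  unfold Gk
  rw [dif_pos ⟨_, hc⟩]
  refine le_trans ?_ (Finset.le_sup'
    (fun m : ℕ => sigmaTop n m u / (m : ℝ) + max 0 (1 - (k : ℝ) / (m : ℝ))) hc)
  gcongr
  exact sum_le_sigmaTop u S

theorem Gk_indic_le_one {n k : ℕ} (hn : 1 ≤ n) {S : Finset (Fin n)} (hS : S.card = k) :
    Gk n k (indic S) ≤ 1 := by
  have h : (Finset.Icc 1 n).Nonempty := Finset.nonempty_Icc.2 hn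
  unfold Gk
  rw [dif_pos h]
  refine Finset.sup'_le _ _ fun m hm => ?_
  obtain ⟨hm1, hmn⟩ := Finset.mem_Icc.1 hm
  obtain ⟨M, hM, hsum⟩ := exists_card_eq_sum_eq_sigmaTop hmn (indic S)
  have hm0 : (0 : ℝ) < m := by exact_mod_cast hm1
  have hval : ∑ i ∈ M, indic S i = ((M ∩ S).card : ℝ) := by
    simp [indic, Finset.sum_ite_mem]
  have h1 : ((M ∩ S).card : ℝ) ≤ m := by
    exact_mod_cast hM ▸ Finset.card_le_card Finset.inter_subset_left
  have h2 : ((M ∩ S).card : ℝ) ≤ k := by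
    exact_mod_cast hS ▸ Finset.card_le_card Finset.inter_subset_right
  rw [← hsum, hval]
  have h3 : ((M ∩ S).card : ℝ) / m ≤ 1 := (div_le_one hm0).2 h1
  have h4 : ((M ∩ S).card : ℝ) / m ≤ k / m := by gcongr
  rcases max_cases (0 : ℝ) (1 - (k : ℝ) / m) with ⟨h, _⟩ | ⟨h, _⟩ <;> rw [h] <;> linarith

theorem le_Gk {n : ℕ} (k : ℕ) (u : Fin n → ℝ) (i : Fin n) : u i ≤ Gk n k u := by
  have h := sum_div_card_add_le_Gk k u (Finset.singleton_nonempty i)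
  have h0 := le_max_left (0 : ℝ) (1 - (k : ℝ) / ({i} : Finset (Fin n)).card)
  simp only [Finset.sum_singleton, Finset.card_singleton, Nat.cast_one, div_one] at h h0
  linarith

/-- After translating `u` so that `Gk` takes the value `1`, its positive part has sum at most `k`. -/
theorem sum_posPart_sub_Gk_le {n : ℕ} (k : ℕ) (u : Fin n → ℝ) :
    ∑ i, max (u i - (Gk n k u - 1)) 0 ≤ k := by
  set c := Gk n k u - 1 with hcdef
  set P := Finset.univ.filter fun i => 0 < u i - c
  have hP : ∑ i, max (u i - c) 0 = ∑ i ∈ P, (u i - c) := by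
    rw [Finset.sum_filter]
    refine Finset.sum_congr rfl fun i _ => ?_
    split_ifs with h
    · exact max_eq_left h.le
    · exact max_eq_right (not_lt.1 h)
  rw [hP]
  rcases le_total P.card k with hk | hk
  · calc ∑ i ∈ P, (u i - c) ≤ ∑ _i ∈ P, (1 : ℝ) :=
          Finset.sum_le_sum fun i _ => by linarith [le_Gk k u i]
      _ ≤ k := by simpa using hk
  · rcases P.eq_empty_or_nonempty with he | hne
    · simp [he]
    have h := sum_div_card_add_le_Gk k u hne
    have h0 := le_max_right (0 : ℝ) (1 - (k : ℝ) / P.card)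
    have hpos : (0 : ℝ) < P.card := by exact_mod_cast hne.card_pos
    have h1 : ((∑ i ∈ P, u i) - k) / P.card ≤ c := by
      rw [sub_div]; linarith
    rw [div_le_iff₀ hpos] at h1
    rw [Finset.sum_sub_distrib, Finset.sum_const, nsmul_eq_mul]
    linarith

/-- Complementary slackness for maximizing `∑ p i * x i` over `0 ≤ x ≤ 1`, `∑ x i ≤ k`. -/
theorem exists_threshold {n k : ℕ} (hk : 1 ≤ k) {p x : Fin n → ℝ} (hp : ∀ i, 0 ≤ p i)
    {S : Finset (Fin n)} (hSc : S.card = k) (hS : ∑ i ∈ S, p i = sigmaTop n k p)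
    (hx0 : ∀ i, 0 ≤ x i) (hx1 : ∀ i, x i ≤ 1) (hxk : ∑ i, x i ≤ k)
    (hopt : ∑ i ∈ S, p i ≤ ∑ i, p i * x i) :
    ∃ t : ℝ, 0 ≤ t ∧ (∀ i, t < p i → x i = 1) ∧ (∀ i, p i < t → x i = 0) ∧
      (0 < t → ∑ i, x i = k) := by
  obtain ⟨a, haS, ha⟩ := S.exists_min_image p (Finset.card_pos.1 (by omega))
  have ht : 0 ≤ p a := hp a
  set f : Fin n → ℝ := fun i => (p i - p a) * ((if i ∈ S then 1 else 0) - x i) with hf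
  have hf0 : ∀ i, 0 ≤ f i := fun i => by
    by_cases hi : i ∈ S
    · simp only [hf, if_pos hi]
      exact mul_nonneg (sub_nonneg.2 (ha i hi)) (sub_nonneg.2 (hx1 i))
    · simp only [hf, if_neg hi]
      have := le_of_mem_of_notMem_of_sum_eq_sigmaTop hSc hS haS hi
      exact mul_nonneg_of_nonpos_of_nonpos (by linarith) (by linarith [hx0 i])
  have hsum : ∑ i, f i = ∑ i ∈ S, p i - ∑ i, p i * x i - p a * (k - ∑ i, x i) := by
    have h1 : ∑ i ∈ S, p i = ∑ i, p i * (if i ∈ S then 1 else 0) := by simp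
    have h2 : (k : ℝ) = ∑ i, if i ∈ S then (1 : ℝ) else 0 := by simp [hSc]
    rw [h1, h2, ← Finset.sum_sub_distrib, ← Finset.sum_sub_distrib, Finset.mul_sum,
      ← Finset.sum_sub_distrib]
    exact Finset.sum_congr rfl fun i _ => by simp only [hf]; ring
  have hnn : 0 ≤ p a * (k - ∑ i, x i) := mul_nonneg ht (sub_nonneg.2 hxk)
  have hfs : 0 ≤ ∑ i, f i := Finset.sum_nonneg fun i _ => hf0 i
  have hzero : ∀ i, f i = 0 := fun i =>
    (Finset.sum_eq_zero_iff_of_nonneg fun i _ => hf0 i).1 (by linarith) i (Finset.mem_univ i)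
  refine ⟨p a, ht, fun i hi => ?_, fun i hi => ?_, fun h => ?_⟩
  · have hiS : i ∈ S := by
      by_contra hiS
      linarith [le_of_mem_of_notMem_of_sum_eq_sigmaTop hSc hS haS hiS]
    have := hzero i
    simp only [hf, if_pos hiS] at this
    rcases mul_eq_zero.1 this with h | h <;> linarith
  · have hiS : i ∉ S := fun hiS => by linarith [ha i hiS]
    have := hzero i
    simp only [hf, if_neg hiS] at this
    rcases mul_eq_zero.1 this with h | h <;> linarith
  · have : p a * (k - ∑ i, x i) = 0 := by linarith
    rcases mul_eq_zero.1 this with h' | h' <;> linarith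

/-- A set containing all entries above a threshold and none below it has maximal sum. -/
theorem sum_eq_sigmaTop_of_threshold {n k : ℕ} (hkn : k ≤ n) {p : Fin n → ℝ}
    {T : Finset (Fin n)} (hT : T.card = k) {t : ℝ} (hout : ∀ j ∉ T, p j ≤ t)
    (hin : ∀ i ∈ T, t ≤ p i) : ∑ i ∈ T, p i = sigmaTop n k p := by
  refine le_antisymm (hT ▸ sum_le_sigmaTop p T) ?_
  obtain ⟨S, hSc, hS⟩ := exists_card_eq_sum_eq_sigmaTop hkn p
  rw [← hS]
  have key : ∑ i ∈ S, (p i - t) ≤ ∑ i ∈ T, (p i - t) := by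
    rw [← Finset.sum_inter_add_sum_sdiff S T, ← Finset.sum_inter_add_sum_sdiff T S,
      Finset.inter_comm T S]
    have h1 : ∑ i ∈ S \ T, (p i - t) ≤ 0 := Finset.sum_nonpos fun i hi =>
      sub_nonpos.2 (hout i (Finset.mem_sdiff.1 hi).2)
    have h2 : 0 ≤ ∑ i ∈ T \ S, (p i - t) := Finset.sum_nonneg fun i hi =>
      sub_nonneg.2 (hin i (Finset.mem_sdiff.1 hi).1)
    linarith
  simp only [Finset.sum_sub_distrib, Finset.sum_const, hSc, hT] at key
  linarith

theorem stmt3 (n k : ℕ) (hk : 1 ≤ k) (hkn : k < n)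
    (ψ : (Fin n → ℝ) → Finset (Fin n))
    (hψ : ∀ u : Fin n → ℝ, (ψ u).card = k ∧ ∑ i ∈ ψ u, u i = sigmaTop n k u) :
    ∀ p ∈ simplex n, ∀ u : Fin n → ℝ,
      (∀ v : Fin n → ℝ, ∑ y, p y * Lk n k u y ≤ ∑ y, p y * Lk n k v y) →
      ∀ u' : Fin n → ℝ,
        ¬ ((ψ u').card = k ∧ (∑ i ∈ ψ u', p i) = sigmaTop n k p) →
        (1 : ℝ) / (2 * n) ≤ ‖u - u'‖ := by
  rintro p ⟨hp0, hp1⟩ u hu u' hnot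
  by_contra! hlt
  have hn : 1 ≤ n := by omega
  have hn0 : (0 : ℝ) < n := by exact_mod_cast hn
  obtain ⟨hTc, hT⟩ := hψ u'
  obtain ⟨hSc, hS⟩ := hψ p
  set T := ψ u'
  set S := ψ p
  set c := Gk n k u - 1 with hc
  set x : Fin n → ℝ := fun i => max (u i - c) 0
  have hx0 : ∀ i, 0 ≤ x i := fun i => le_max_right _ _
  have hx1 : ∀ i, x i ≤ 1 := fun i => max_le (by linarith [le_Gk k u i]) zero_le_one
  have hxk : ∑ i, x i ≤ k := sum_posPart_sub_Gk_le k u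
  have hopt : ∑ i ∈ S, p i ≤ ∑ i, p i * x i := by
    have h := hu (indic S)
    rw [sum_mul_Lk hn k hp1, sum_mul_Lk hn k hp1] at h
    have h1 := Gk_indic_le_one hn hSc
    have h2 : ∑ y, p y * indic S y = ∑ i ∈ S, p i := by simp [indic]
    have h3 : ∑ i, p i * (u i - c) ≤ ∑ i, p i * x i := Finset.sum_le_sum fun i _ =>
      mul_le_mul_of_nonneg_left (le_max_left _ _) (hp0 i)
    simp only [mul_sub, Finset.sum_sub_distrib, ← Finset.sum_mul, hp1] at h3
    linarith
  have hclose : ∀ i ∈ T, ∀ j ∉ T, x j < x i + 1 / n := by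
    intro i hi j hj
    have hord := le_of_mem_of_notMem_of_sum_eq_sigmaTop hTc hT hi hj
    have hi' := abs_le.1 (norm_le_pi_norm (u - u') i)
    have hj' := abs_le.1 (norm_le_pi_norm (u - u') j)
    simp only [Pi.sub_apply] at hi' hj'
    have hhalf : (1 : ℝ) / n = 1 / (2 * n) + 1 / (2 * n) := by field_simp; norm_num
    have hinv : (0 : ℝ) < 1 / n := by positivity
    exact max_lt (by linarith [le_max_left (u i - c) 0, hi'.1, hj'.2]) (by linarith [hx0 i])
  have hsplit := Finset.sum_add_sum_compl T x
  obtain ⟨t, ht0, hone, hzero, hfull⟩ := exists_threshold hk hp0 hSc hS hx0 hx1 hxk hopt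
  refine hnot ⟨hTc, sum_eq_sigmaTop_of_threshold hkn.le hTc (t := t) ?_ ?_⟩
  · intro j hj
    by_contra! hjt
    have hxj := hone j hjt
    have h1 : 1 ≤ ∑ i ∈ Tᶜ, x i := hxj ▸
      Finset.single_le_sum (fun i _ => hx0 i) (Finset.mem_compl.2 hj)
    have h2 : ∑ _i ∈ T, (1 - 1 / (n : ℝ)) ≤ ∑ i ∈ T, x i := Finset.sum_le_sum fun i hi => by
      linarith [hclose i hi j hj]
    rw [Finset.sum_const, hTc, nsmul_eq_mul, mul_sub, mul_one, mul_one_div] at h2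
    have h3 : (k : ℝ) / n < 1 := (div_lt_one hn0).2 (by exact_mod_cast hkn)
    linarith
  · intro i hi
    by_contra! hit
    have hxi := hzero i hit
    have hsum := hfull ((hp0 i).trans_lt hit)
    have h1 : ∑ j ∈ T.erase i, x j ≤ ∑ _j ∈ T.erase i, (1 : ℝ) :=
      Finset.sum_le_sum fun j _ => hx1 j
    have h2 : ∑ j ∈ Tᶜ, x j ≤ ∑ _j ∈ Tᶜ, 1 / (n : ℝ) := Finset.sum_le_sum fun j hj => by
      linarith [hclose i hi j (Finset.mem_compl.1 hj)]
    have h3 := Finset.add_sum_erase T x hi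
    have h4 : ((T.erase i).card : ℝ) + 1 = k := by
      exact_mod_cast hTc ▸ Finset.card_erase_add_one hi
    have h5 : (Tᶜ.card : ℝ) < n := by
      have : Tᶜ.card < n := by rw [Finset.card_compl, Fintype.card_fin]; omega
      exact_mod_cast this
    rw [Finset.sum_const, nsmul_eq_mul, mul_one] at h1
    rw [Finset.sum_const, nsmul_eq_mul, mul_one_div] at h2
    have h6 : (Tᶜ.card : ℝ) / n < 1 := (div_lt_one hn0).2 h5
    linarith
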